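/- Let a₁,…,a_N ∈ 𝔻 be distinct points and m₁,…,m_N positive integers. For each k, let a^{(k)}_{j,i} ∈ 𝔻 (1 ≤ j ≤ N, 1 ≤ i ≤ mⱼ) be pairwise distinct points such that lim_{k→∞} a^{(k)}_{j,i} = aⱼ for every i, j. Let ℓ_k(z) := inf{ Σ_{j,i} log|ζ_{j,i}| : there exist an analytic disc φ in 𝔻² and points ζ_{j,i} ∈ 𝔻 with φ(0) = z and φ(ζ_{j,i}) = (a^{(k)}_{j,i}, 0) for all j, i } be Coman's Lempert function for these simple poles with weight 1. Then for every z = (z₁,z₂) ∈ 𝔻², lim_{k→∞} ℓ_k(z) = max{ Σ_{j=1}^N mⱼ·log|φ_{aⱼ}(z₁)| , log|z₂| }. -/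

import Mathlib

open Complex Metric Filter Topology

noncomputable section

/-- The open unit disc in `ℂ`. -/
def unitDisc : Set ℂ := Metric.ball 0 1

/-- Extended-real logarithm, with the convention `log 0 = ⊥`. -/
def elog (x : ℝ) : EReal := if x = 0 then ⊥ else ((Real.log x : ℝ) : EReal)

/-- The Möbius involution of the unit disc exchanging `ξ` and `0`. -/
def mobius (ξ ζ : ℂ) : ℂ := (ξ - ζ) / (1 - (starRingEnd ℂ) ξ * ζ)

/-- An analytic disc in the bidisc `𝔻²`, given by its two components. -/
def AnalyticDisc2 (φ₁ φ₂ : ℂ → ℂ) : Prop :=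
  DifferentiableOn ℂ φ₁ unitDisc ∧ DifferentiableOn ℂ φ₂ unitDisc ∧
  (∀ w ∈ unitDisc, φ₁ w ∈ unitDisc) ∧ (∀ w ∈ unitDisc, φ₂ w ∈ unitDisc)

lemma mem_ud {w : ℂ} : w ∈ unitDisc ↔ ‖w‖ < 1 := by simp [unitDisc]

lemma den_ne {ξ ζ : ℂ} (h1 : ‖ξ‖ < 1) (h2 : ‖ζ‖ < 1) : 1 - (starRingEnd ℂ) ξ * ζ ≠ 0 := by
  intro h
  have h3 : (starRingEnd ℂ) ξ * ζ = 1 := (sub_eq_zero.1 h).symm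
  have h4 : ‖ξ‖ * ‖ζ‖ = 1 := by
    have := congrArg norm h3
    simpa using this
  nlinarith [norm_nonneg ξ, norm_nonneg ζ]

lemma mob_lt {ξ ζ : ℂ} (h1 : ‖ξ‖ < 1) (h2 : ‖ζ‖ < 1) : ‖mobius ξ ζ‖ < 1 := by
  have hd := den_ne h1 h2
  rw [mobius, norm_div, div_lt_one (norm_pos_iff.2 hd)]
  refine lt_of_pow_lt_pow_left₀ 2 (norm_nonneg _) ?_
  have e1 : ‖ξ‖ ^ 2 < 1 := by nlinarith [norm_nonneg ξ]
  have e2 : ‖ζ‖ ^ 2 < 1 := by nlinarith [norm_nonneg ζ]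
  simp only [Complex.sq_norm, Complex.normSq_apply] at *
  simp only [sub_re, sub_im, mul_re, mul_im, conj_re, conj_im, one_re, one_im]
  nlinarith [mul_pos (sub_pos.2 e1) (sub_pos.2 e2)]

lemma mob_mem {ξ ζ : ℂ} (h1 : ξ ∈ unitDisc) (h2 : ζ ∈ unitDisc) : mobius ξ ζ ∈ unitDisc :=
  mem_ud.2 (mob_lt (mem_ud.1 h1) (mem_ud.1 h2))

lemma mob_diff {ξ : ℂ} (h1 : ξ ∈ unitDisc) : DifferentiableOn ℂ (mobius ξ) unitDisc := by
  unfold mobius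
  refine DifferentiableOn.div (by fun_prop) (by fun_prop) ?_
  intro w hw
  exact den_ne (mem_ud.1 h1) (mem_ud.1 hw)

lemma mob_invol {ξ ζ : ℂ} (h1 : ξ ∈ unitDisc) (h2 : ζ ∈ unitDisc) :
    mobius ξ (mobius ξ ζ) = ζ := by
  have hd := den_ne (mem_ud.1 h1) (mem_ud.1 h2)
  have hd2 := den_ne (mem_ud.1 h1) (mem_ud.1 (mob_mem h1 h2))
  have hd3 := den_ne (mem_ud.1 h1) (mem_ud.1 h1)
  have key : mobius ξ ζ * (1 - (starRingEnd ℂ) ξ * ζ) = ξ - ζ := by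
    rw [mobius, div_mul_cancel₀ _ hd]
  rw [mobius, div_eq_iff hd2]
  linear_combination -key

lemma mob_self (ξ : ℂ) : mobius ξ ξ = 0 := by simp [mobius]
lemma mob_zero (ξ : ℂ) : mobius ξ 0 = ξ := by simp [mobius]
lemma zero_ud : (0 : ℂ) ∈ unitDisc := by simp [mem_ud]

lemma mob_ne {ξ ζ : ℂ} (h1 : ξ ∈ unitDisc) (h2 : ζ ∈ unitDisc) (h : ζ ≠ ξ) :
    mobius ξ ζ ≠ 0 := by
  rw [mobius]
  exact div_ne_zero (sub_ne_zero.2 h.symm) (den_ne (mem_ud.1 h1) (mem_ud.1 h2))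

lemma mob_norm_symm (ξ ζ : ℂ) : ‖mobius ξ ζ‖ = ‖mobius ζ ξ‖ := by
  rw [mobius, mobius, norm_div, norm_div, norm_sub_rev]
  congr 1
  rw [← Complex.norm_conj]
  simp [mul_comm]

/-- Dividing out one zero. -/
lemma divide_zero {f : ℂ → ℂ} (hf : DifferentiableOn ℂ f unitDisc)
    (hb : ∀ w ∈ unitDisc, ‖f w‖ ≤ 1) {ζ : ℂ} (hζ : ζ ∈ unitDisc) (h0 : f ζ = 0) :
    ∃ h : ℂ → ℂ, DifferentiableOn ℂ h unitDisc ∧ (∀ w ∈ unitDisc, ‖h w‖ ≤ 1) ∧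
      ∀ w ∈ unitDisc, f w = mobius ζ w * h w := by
  set F : ℂ → ℂ := fun w => f (mobius ζ w) with hF
  have hmaps : Set.MapsTo (mobius ζ) unitDisc unitDisc := fun w hw => mob_mem hζ hw
  have hFd : DifferentiableOn ℂ F unitDisc := hf.comp (mob_diff hζ) hmaps
  have hF0 : F 0 = 0 := by simp [hF, mob_zero, h0]
  have hFb : Set.MapsTo F (ball 0 1) (closedBall (F 0) 1) := by
    intro w hw
    rw [hF0, mem_closedBall_zero_iff]
    exact hb _ (hmaps hw)
  have hds : DifferentiableOn ℂ (dslope F 0) unitDisc :=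
    (Complex.differentiableOn_dslope (isOpen_ball.mem_nhds zero_ud)).2 hFd
  refine ⟨fun w => dslope F 0 (mobius ζ w), hds.comp (mob_diff hζ) hmaps, ?_, ?_⟩
  · intro w hw
    have := Complex.norm_dslope_le_div_of_mapsTo_ball hFd hFb (hmaps hw)
    simpa using this
  · intro w hw
    have := sub_smul_dslope F 0 (mobius ζ w)
    rw [hF0, sub_zero, sub_zero, smul_eq_mul] at this
    rw [this]
    simp [hF, mob_invol hζ hw]

lemma zeros_bound {ι : Type*} (s : Finset ι) (ζ : ι → ℂ) (hinj : Function.Injective ζ)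
    (hζ : ∀ p, ζ p ∈ unitDisc) : ∀ f : ℂ → ℂ, DifferentiableOn ℂ f unitDisc →
    (∀ w ∈ unitDisc, ‖f w‖ ≤ 1) → (∀ p ∈ s, f (ζ p) = 0) → ‖f 0‖ ≤ ∏ p ∈ s, ‖ζ p‖ := by
  classical
  induction s using Finset.induction_on with
  | empty =>
    intro f _ hb _
    simpa using hb 0 zero_ud
  | insert p s hp ih =>
    intro f hf hb hz
    obtain ⟨h, hd, hhb, heq⟩ := divide_zero hf hb (hζ p) (hz p (Finset.mem_insert_self _ _))
    have hh := ih h hd hhb (by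
      intro q hq
      have h1 := heq (ζ q) (hζ q)
      rw [hz q (Finset.mem_insert_of_mem hq)] at h1
      have hne : ζ q ≠ ζ p := fun e => hp (hinj e ▸ hq)
      exact (mul_eq_zero.1 h1.symm).resolve_left (mob_ne (hζ p) (hζ q) hne))
    rw [heq 0 zero_ud, mob_zero, norm_mul, Finset.prod_insert hp]
    gcongr

/-- The second component: a multiple of a Blaschke product. -/
lemma exists_second {ι : Type*} [Fintype ι] (ζ : ι → ℂ) (hζ : ∀ p, ζ p ∈ unitDisc)
    (w₀ : ℂ) (hw : w₀ ∈ unitDisc) (hle : ‖w₀‖ ≤ ∏ p, ‖ζ p‖) :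
    ∃ f : ℂ → ℂ, DifferentiableOn ℂ f unitDisc ∧ (∀ w ∈ unitDisc, f w ∈ unitDisc) ∧
      f 0 = w₀ ∧ ∀ p, f (ζ p) = 0 := by
  classical
  by_cases h0 : w₀ = 0
  · exact ⟨fun _ => 0, by fun_prop, fun _ _ => zero_ud, h0.symm, fun _ => rfl⟩
  have hpos : 0 < ∏ p, ‖ζ p‖ := lt_of_lt_of_le (norm_pos_iff.2 h0) hle
  have hprod : ∏ p, ζ p ≠ 0 := by
    rw [← norm_pos_iff, norm_prod]; exact hpos
  have hc : ‖w₀ / ∏ p, ζ p‖ ≤ 1 := by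
    rw [norm_div, norm_prod]; exact (div_le_one hpos).2 hle
  refine ⟨fun w => (w₀ / ∏ p, ζ p) * ∏ p, mobius (ζ p) w, ?_, ?_, ?_, ?_⟩
  · exact (differentiableOn_const _).mul (DifferentiableOn.fun_finsetProd fun p _ => mob_diff (hζ p))
  · intro w hww
    rw [mem_ud, norm_mul, norm_prod]
    rcases isEmpty_or_nonempty ι with hι | ⟨⟨p⟩⟩
    · simpa using mem_ud.1 hw
    · have h1 : ∏ p, ‖mobius (ζ p) w‖ < 1 := by
        rw [← Finset.mul_prod_erase _ _ (Finset.mem_univ p)]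
        have h2 : ∏ q ∈ Finset.univ.erase p, ‖mobius (ζ q) w‖ ≤ 1 :=
          Finset.prod_le_one (fun _ _ => norm_nonneg _)
            (fun q _ => (mem_ud.1 (mob_mem (hζ q) hww)).le)
        have h3 := mem_ud.1 (mob_mem (hζ p) hww)
        calc _ ≤ ‖mobius (ζ p) w‖ * 1 := by gcongr
          _ < 1 := by simpa using h3
      calc _ ≤ 1 * ∏ p, ‖mobius (ζ p) w‖ := by
            gcongr
        _ < 1 := by simpa using h1
  · simp only [mob_zero]
    exact div_mul_cancel₀ _ hprod
  · intro p
    simp only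
    have hz : ∏ q, mobius (ζ q) (ζ p) = 0 :=
      Finset.prod_eq_zero (Finset.mem_univ p) (mob_self (ζ p))
    rw [hz, mul_zero]

/-- The degree two Blaschke product interpolating between `ζ` and `ζ²`. -/
def fc (c : ℝ) (ζ : ℂ) : ℂ := ζ * ((ζ + c) / (1 + c * ζ))

lemma fc_den {c : ℝ} (h0 : 0 ≤ c) (h1 : c ≤ 1) {ζ : ℂ} (hζ : ζ ∈ unitDisc) :
    1 + (c : ℂ) * ζ ≠ 0 := by
  intro h
  have h3 : (c : ℂ) * ζ = -1 := by linear_combination h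
  have h4 : c * ‖ζ‖ = 1 := by
    have := congrArg norm h3
    simpa [abs_of_nonneg h0] using this
  nlinarith [norm_nonneg ζ, mem_ud.1 hζ]

lemma fc_mem {c : ℝ} (h0 : 0 ≤ c) (h1 : c ≤ 1) {ζ : ℂ} (hζ : ζ ∈ unitDisc) :
    fc c ζ ∈ unitDisc := by
  have hd := fc_den h0 h1 hζ
  have h2 := mem_ud.1 hζ
  rw [mem_ud, fc, norm_mul]
  have h3 : ‖(ζ + c) / (1 + c * ζ)‖ ≤ 1 := by
    rw [norm_div, div_le_one (norm_pos_iff.2 hd)]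
    refine le_of_sq_le_sq ?_ (norm_nonneg _)
    have e2 : ‖ζ‖ ^ 2 < 1 := by nlinarith [norm_nonneg ζ]
    have e1 : c ^ 2 ≤ 1 := by nlinarith
    simp only [Complex.sq_norm, Complex.normSq_apply] at *
    simp only [add_re, add_im, mul_re, mul_im, ofReal_re, ofReal_im, one_re, one_im]
    nlinarith [mul_nonneg (sub_nonneg.2 e1) (sub_pos.2 e2).le]
  calc _ ≤ ‖ζ‖ * 1 := by gcongr
    _ < 1 := by simpa using h2

lemma fc_diff {c : ℝ} (h0 : 0 ≤ c) (h1 : c ≤ 1) : DifferentiableOn ℂ (fc c) unitDisc := by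
  unfold fc
  refine DifferentiableOn.mul (by fun_prop) (DifferentiableOn.div (by fun_prop) (by fun_prop) ?_)
  intro w hw
  exact fc_den h0 h1 hw

def Sf (α : ℂ) (c : ℝ) : ℝ := (‖(c : ℂ) * (1 - α)‖ ^ 2 + ‖((c : ℂ) * (1 - α)) ^ 2 + 4 * α‖) / 2

/-- Modulus of the smallest root of `ζ² + c(1-α)ζ - α`. -/
def rho (α : ℂ) (c : ℝ) : ℝ :=
  √((Sf α c - √((Sf α c) ^ 2 - 4 * ‖α‖ ^ 2)) / 2)

lemma rho_cont (α : ℂ) : Continuous (rho α) := by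
  unfold rho Sf
  fun_prop

/-- Explicit smallest root. -/
lemma rho_roots (α : ℂ) (c : ℝ) (x y : ℂ) (hs : x + y = -(c * (1 - α))) (hp : x * y = -α) :
    rho α c = min ‖x‖ ‖y‖ := by
  have hD : ((c : ℂ) * (1 - α)) ^ 2 + 4 * α = (x - y) ^ 2 := by
    have h1 : (c : ℂ) * (1 - α) = -(x + y) := by rw [hs]; ring
    have h2 : α = -(x * y) := by rw [hp]; ring
    rw [h1, h2]; ring
  have hS : Sf α c = ‖x‖ ^ 2 + ‖y‖ ^ 2 := by
    have h1 : (c : ℂ) * (1 - α) = -(x + y) := by rw [hs]; ring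
    rw [Sf, hD, h1, norm_neg, norm_pow]
    have := parallelogram_law_with_norm ℝ x y
    nlinarith
  have hP : ‖α‖ = ‖x‖ * ‖y‖ := by rw [← norm_mul, hp, norm_neg]
  have hq : (Sf α c) ^ 2 - 4 * ‖α‖ ^ 2 = (‖x‖ ^ 2 - ‖y‖ ^ 2) ^ 2 := by
    rw [hS, hP]; ring
  rw [rho, hq, Real.sqrt_sq_eq_abs, hS]
  have hx := norm_nonneg x
  have hy := norm_nonneg y
  rcases le_total ‖x‖ ‖y‖ with h | h
  · rw [min_eq_left h, abs_of_nonpos (by nlinarith)]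
    rw [show (‖x‖ ^ 2 + ‖y‖ ^ 2 - -(‖x‖ ^ 2 - ‖y‖ ^ 2)) / 2 = ‖x‖ ^ 2 by ring, Real.sqrt_sq hx]
  · rw [min_eq_right h, abs_of_nonneg (by nlinarith)]
    rw [show (‖x‖ ^ 2 + ‖y‖ ^ 2 - (‖x‖ ^ 2 - ‖y‖ ^ 2)) / 2 = ‖y‖ ^ 2 by ring, Real.sqrt_sq hy]

lemma rho_one {α : ℂ} (h : α ∈ unitDisc) : rho α 1 = ‖α‖ := by
  rw [rho_roots α 1 α (-1) (by push_cast; ring) (by ring)]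
  simpa using (mem_ud.1 h).le

lemma rho_zero {α β : ℂ} (h : β ^ 2 = α) : rho α 0 = ‖β‖ := by
  rw [rho_roots α 0 β (-β) (by push_cast; ring) (by rw [← h]; ring)]
  simp

lemma rho_root {α : ℂ} (h : α ∈ unitDisc) {c : ℝ} (h0 : 0 ≤ c) (h1 : c ≤ 1) :
    ∃ ζ ∈ unitDisc, fc c ζ = α ∧ ‖ζ‖ = rho α c := by
  obtain ⟨s, hs⟩ := IsAlgClosed.exists_pow_nat_eq (((c : ℂ) * (1 - α)) ^ 2 + 4 * α)
    (n := 2) (by norm_num)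
  obtain ⟨x, y, hxy, hp, hle⟩ : ∃ x y : ℂ, x + y = -(c * (1 - α)) ∧ x * y = -α ∧ ‖x‖ ≤ ‖y‖ := by
    have e1 : (-(c * (1 - α)) + s) / 2 + (-(c * (1 - α)) - s) / 2 = -(c * (1 - α)) := by ring
    have e2 : (-(c * (1 - α)) + s) / 2 * ((-(c * (1 - α)) - s) / 2) = -α := by
      linear_combination -hs / 4
    rcases le_total ‖(-(c * (1 - α)) + s) / 2‖ ‖(-(c * (1 - α)) - s) / 2‖ with hl | hl
    · exact ⟨_, _, e1, e2, hl⟩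
    · exact ⟨_, _, by rw [add_comm]; exact e1, by rw [mul_comm]; exact e2, hl⟩
  have hx : x ∈ unitDisc := by
    rw [mem_ud]
    have hP : ‖x‖ * ‖y‖ < 1 := by rw [← norm_mul, hp, norm_neg]; exact mem_ud.1 h
    nlinarith [norm_nonneg x]
  refine ⟨x, hx, ?_, ?_⟩
  · rw [fc, ← mul_div_assoc, div_eq_iff (fc_den h0 h1 hx)]
    linear_combination x * hxy - hp
  · rw [rho_roots α c x y hxy hp, min_eq_left hle]

/-- Conclusion of the interpolation construction. -/
def Interp {ι : Type*} [Fintype ι] (α : ι → ℂ) (y : ℝ) : Prop :=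
  ∃ (f : ℂ → ℂ) (ζ : ι → ℂ), DifferentiableOn ℂ f unitDisc ∧ (∀ w ∈ unitDisc, f w ∈ unitDisc) ∧
    f 0 = 0 ∧ (∀ p, ζ p ∈ unitDisc) ∧ (∀ p, f (ζ p) = α p) ∧ ∏ p, ‖ζ p‖ = y

lemma Interp.self {ι : Type*} [Fintype ι] (α : ι → ℂ) (hα : ∀ p, α p ∈ unitDisc) :
    Interp α (∏ p, ‖α p‖) :=
  ⟨id, α, differentiableOn_id, fun _ hw => hw, rfl, hα, fun _ => rfl, rfl⟩

lemma Interp.sq {ι : Type*} [Fintype ι] {α β : ι → ℂ} {y : ℝ} (h : Interp β y)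
    (hβ : ∀ p, β p ^ 2 = α p) : Interp α y := by
  obtain ⟨f, ζ, h1, h2, h3, h4, h5, h6⟩ := h
  refine ⟨fun w => f w ^ 2, ζ, h1.pow 2, ?_, by simp [h3], h4, by simp [h5, hβ], h6⟩
  intro w hw
  have := mem_ud.1 (h2 w hw)
  rw [mem_ud, norm_pow]
  nlinarith [norm_nonneg (f w)]

lemma exists_sqrt {ι : Type*} (α : ι → ℂ) (hα : ∀ p, α p ∈ unitDisc) :
    ∃ β : ι → ℂ, (∀ p, β p ∈ unitDisc) ∧ ∀ p, β p ^ 2 = α p := by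
  choose β hβ using fun p => IsAlgClosed.exists_pow_nat_eq (α p) (n := 2) (by norm_num)
  refine ⟨β, fun p => ?_, hβ⟩
  have := mem_ud.1 (hα p)
  rw [← hβ, norm_pow] at this
  rw [mem_ud]
  nlinarith [norm_nonneg (β p)]

lemma interp_nonzero {ι : Type*} [Fintype ι] {y : ℝ} (hy : 0 < y) (l : ℕ) :
    ∀ α : ι → ℂ, (∀ p, α p ∈ unitDisc) → ∏ p, ‖α p‖ ≤ y → y ^ 2 ^ l ≤ ∏ p, ‖α p‖ →
      Interp α y := by
  induction l with
  | zero =>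
    intro α hα h1 h2
    exact ⟨id, α, differentiableOn_id, fun w hw => hw, rfl, hα, fun p => rfl,
      le_antisymm h1 (by simpa using h2)⟩
  | succ l ih =>
    intro α hα h1 h2
    obtain ⟨β, hβ, hβ2⟩ := exists_sqrt α hα
    by_cases hc : ∏ p, ‖β p‖ ≤ y
    · refine (ih β hβ hc ?_).sq hβ2
      have : ∏ p, ‖α p‖ = (∏ p, ‖β p‖) ^ 2 := by
        rw [← Finset.prod_pow]; simp [← hβ2]
      rw [this, pow_succ, pow_mul] at h2
      exact le_of_sq_le_sq h2 (Finset.prod_nonneg fun _ _ => norm_nonneg _)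
    · push Not at hc
      have hcont : ContinuousOn (fun c : ℝ => ∏ p, rho (α p) c) (Set.Icc 0 1) :=
        (continuous_finsetProd _ fun p _ => rho_cont (α p)).continuousOn
      have := intermediate_value_Icc' zero_le_one hcont
      obtain ⟨c, ⟨hc0, hc1⟩, hcy⟩ := this (show y ∈ _ by
        refine ⟨?_, ?_⟩
        · simpa [rho_one (hα _)] using h1
        · simpa [rho_zero (hβ2 _)] using hc.le)
      choose ζ hζ hf hn using fun p => rho_root (hα p) hc0 hc1
      exact ⟨fc c, ζ, fc_diff hc0 hc1, fun w hw => fc_mem hc0 hc1 hw, by simp [fc], hζ, hf,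
        by simpa [hn] using hcy⟩

lemma interp_zero {ι : Type*} [Fintype ι] [DecidableEq ι] {y : ℝ} (hy : 0 < y) (q : ι) (l : ℕ) :
    ∀ α : ι → ℂ, (∀ p, α p ∈ unitDisc) → α q = 0 →
      y ^ 2 ^ l < ∏ p ∈ Finset.univ.erase q, ‖α p‖ → Interp α y := by
  induction l with
  | zero =>
    intro α hα hq h2
    have hcont : ContinuousOn (fun c : ℝ => c * ∏ p ∈ Finset.univ.erase q, rho (α p) c)
        (Set.Icc 0 1) :=
      (continuous_id.mul (continuous_finsetProd _ fun p _ => rho_cont (α p))).continuousOn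
    have hone : ∏ p ∈ Finset.univ.erase q, rho (α p) 1 = ∏ p ∈ Finset.univ.erase q, ‖α p‖ :=
      Finset.prod_congr rfl fun p _ => rho_one (hα p)
    simp only [pow_zero, pow_one] at h2
    obtain ⟨c, ⟨hc0, hc1⟩, hcy⟩ := intermediate_value_Icc zero_le_one hcont (show y ∈ _ by
        refine ⟨by simpa using hy.le, ?_⟩
        simp only [hone, one_mul]
        exact h2.le)
    simp only at hcy
    have hc1' : c < 1 := by
      refine lt_of_le_of_ne hc1 ?_
      rintro rfl
      rw [hone] at hcy
      linarith
    choose ζ hζ hf hn using fun p => rho_root (hα p) hc0 hc1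
    have hcm : -(c : ℂ) ∈ unitDisc := by
      rw [mem_ud]; simpa [abs_of_nonneg hc0] using hc1'
    refine ⟨fc c, Function.update ζ q (-(c : ℂ)), fc_diff hc0 hc1,
      fun w hw => fc_mem hc0 hc1 hw, by simp [fc], ?_, ?_, ?_⟩
    · intro p
      by_cases hp : p = q
      · subst hp; simpa using hcm
      · simpa [hp] using hζ p
    · intro p
      by_cases hp : p = q
      · subst hp; simp [fc, hq]
      · simpa [hp] using hf p
    · rw [← Finset.mul_prod_erase _ _ (Finset.mem_univ q), ← hcy]
      congr 1
      · simp [abs_of_nonneg hc0]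
      · refine Finset.prod_congr rfl fun p hp => ?_
        rw [Function.update_of_ne (Finset.ne_of_mem_erase hp), hn]
  | succ l ih =>
    intro α hα hq h2
    obtain ⟨β, hβ, hβ2⟩ := exists_sqrt α hα
    refine (ih β hβ ?_ ?_).sq hβ2
    · have := hβ2 q
      rw [hq] at this
      exact pow_eq_zero_iff (two_ne_zero) |>.1 this
    · have : ∏ p ∈ Finset.univ.erase q, ‖α p‖ = (∏ p ∈ Finset.univ.erase q, ‖β p‖) ^ 2 := by
        rw [← Finset.prod_pow]; simp [← hβ2]
      rw [this, pow_succ, pow_mul] at h2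
      exact lt_of_pow_lt_pow_left₀ 2 (Finset.prod_nonneg fun _ _ => norm_nonneg _) h2

lemma exists_pow_two_pow_lt {x y : ℝ} (hy : 0 < y) (hy1 : y < 1) (hx : 0 < x) :
    ∃ l : ℕ, y ^ 2 ^ l < x := by
  obtain ⟨n, hn⟩ := exists_pow_lt_of_lt_one hx hy1
  exact ⟨n, lt_of_le_of_lt (pow_le_pow_of_le_one hy.le hy1.le (Nat.lt_two_pow_self).le) hn⟩

lemma interp {ι : Type*} [Fintype ι] (α : ι → ℂ) (hinj : Function.Injective α)
    (hα : ∀ p, α p ∈ unitDisc) {y : ℝ} (hy : 0 < y) (hy1 : y < 1) (hle : ∏ p, ‖α p‖ ≤ y) :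
    Interp α y := by
  classical
  by_cases h : ∃ q, α q = 0
  · obtain ⟨q, hq⟩ := h
    have : 0 < ∏ p ∈ Finset.univ.erase q, ‖α p‖ := by
      refine Finset.prod_pos fun p hp => norm_pos_iff.2 fun h0 => ?_
      exact Finset.ne_of_mem_erase hp (hinj (h0.trans hq.symm))
    obtain ⟨l, hl⟩ := exists_pow_two_pow_lt hy hy1 this
    exact interp_zero hy q l α hα hq hl
  · push Not at h
    obtain ⟨l, hl⟩ := exists_pow_two_pow_lt hy hy1
      (Finset.prod_pos fun p (_ : p ∈ Finset.univ) => norm_pos_iff.2 (h p))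
    exact interp_nonzero hy l α hα hle hl.le

lemma elog_eq {x : ℝ} (hx : 0 ≤ x) : elog x = ENNReal.log (ENNReal.ofReal x) := by
  rw [elog, ENNReal.log_ofReal]
  by_cases h : x = 0
  · simp [h]
  · have : ¬ x ≤ 0 := fun h' => h (le_antisymm h' hx)
    simp [h, this]

lemma elog_mono {x y : ℝ} (hx : 0 ≤ x) (h : x ≤ y) : elog x ≤ elog y := by
  rw [elog_eq hx, elog_eq (hx.trans h)]
  exact ENNReal.log_monotone (ENNReal.ofReal_le_ofReal h)

lemma elog_max {x y : ℝ} (hx : 0 ≤ x) (hy : 0 ≤ y) : elog (max x y) = max (elog x) (elog y) := by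
  rcases le_total x y with h | h
  · rw [max_eq_right h, max_eq_right (elog_mono hx h)]
  · rw [max_eq_left h, max_eq_left (elog_mono hy h)]

lemma elog_mul {x y : ℝ} (hx : 0 ≤ x) (hy : 0 ≤ y) : elog (x * y) = elog x + elog y := by
  rw [elog_eq hx, elog_eq hy, elog_eq (mul_nonneg hx hy), ENNReal.ofReal_mul hx,
    ENNReal.log_mul_add]

lemma elog_pow {x : ℝ} (hx : 0 ≤ x) (n : ℕ) : elog (x ^ n) = ((n : ℝ) : EReal) * elog x := by
  rw [elog_eq hx, elog_eq (pow_nonneg hx n), ENNReal.ofReal_pow hx, ENNReal.log_pow]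
  simp

lemma elog_prod {ι : Type*} (s : Finset ι) (x : ι → ℝ) (hx : ∀ p, 0 ≤ x p) :
    elog (∏ p ∈ s, x p) = ∑ p ∈ s, elog (x p) := by
  classical
  induction s using Finset.induction_on with
  | empty => simp [elog]
  | insert p s hp ih =>
    rw [Finset.prod_insert hp, Finset.sum_insert hp,
      elog_mul (hx p) (Finset.prod_nonneg fun q _ => hx q), ih]

lemma elog_tendsto {u : ℕ → ℝ} {x : ℝ} (hu : ∀ k, 0 ≤ u k) (hx : 0 ≤ x)
    (h : Tendsto u atTop (𝓝 x)) : Tendsto (fun k => elog (u k)) atTop (𝓝 (elog x)) := by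
  rw [elog_eq hx, funext fun k => elog_eq (hu k)]
  exact (ENNReal.continuous_log.tendsto _).comp (ENNReal.tendsto_ofReal h)

/-- Exact formula for the Lempert function. -/
lemma lempert_exact {N : ℕ} {m : Fin N → ℕ} (B : (j : Fin N) → Fin (m j) → ℂ)
    (hB : ∀ j i, B j i ∈ unitDisc)
    (hdist : Function.Injective (fun p : (Σ j : Fin N, Fin (m j)) => B p.1 p.2))
    (z : ℂ × ℂ) (hz1 : z.1 ∈ unitDisc) (hz2 : z.2 ∈ unitDisc) :
    sInf { t : EReal |
        ∃ (φ₁ φ₂ : ℂ → ℂ) (ζ : (j : Fin N) → Fin (m j) → ℂ),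
          AnalyticDisc2 φ₁ φ₂ ∧ φ₁ 0 = z.1 ∧ φ₂ 0 = z.2 ∧
          (∀ j i, ζ j i ∈ unitDisc) ∧
          (∀ j i, φ₁ (ζ j i) = B j i ∧ φ₂ (ζ j i) = 0) ∧
          t = ∑ j, ∑ i, elog ‖ζ j i‖ } =
      elog (max (∏ j, ∏ i, ‖mobius (B j i) z.1‖) ‖z.2‖) := by
  have hsum : ∀ ζ : (j : Fin N) → Fin (m j) → ℂ, ∑ j, ∑ i, elog ‖ζ j i‖ =
      elog (∏ p : (Σ j : Fin N, Fin (m j)), ‖ζ p.1 p.2‖) := by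
    intro ζ
    rw [elog_prod _ _ (fun _ => norm_nonneg _), Fintype.sum_sigma]
  have hprod : ∏ j, ∏ i, ‖mobius (B j i) z.1‖ =
      ∏ p : (Σ j : Fin N, Fin (m j)), ‖mobius z.1 (B p.1 p.2)‖ := by
    rw [Fintype.prod_sigma]
    exact Finset.prod_congr rfl fun j _ => Finset.prod_congr rfl fun i _ => mob_norm_symm _ _
  have hPnn : 0 ≤ ∏ p : (Σ j : Fin N, Fin (m j)), ‖mobius z.1 (B p.1 p.2)‖ :=
    Finset.prod_nonneg fun _ _ => norm_nonneg _
  apply le_antisymm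
  · apply sInf_le
    rw [hprod]
    have hαm : ∀ p : (Σ j : Fin N, Fin (m j)),
        (fun p : (Σ j : Fin N, Fin (m j)) => mobius z.1 (B p.1 p.2)) p ∈ unitDisc :=
      fun p => mob_mem hz1 (hB p.1 p.2)
    have hαinj : Function.Injective
        (fun p : (Σ j : Fin N, Fin (m j)) => mobius z.1 (B p.1 p.2)) := by
      intro p q hpq
      apply hdist
      have h1 := congrArg (mobius z.1) hpq
      change mobius z.1 (mobius z.1 (B p.1 p.2)) = mobius z.1 (mobius z.1 (B q.1 q.2)) at h1
      rw [mob_invol hz1 (hB p.1 p.2), mob_invol hz1 (hB q.1 q.2)] at h1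
      exact h1
    -- first component with prescribed product
    obtain ⟨f, ζ, hf, hfm, hf0, hζ, hfζ, hval⟩ :
        Interp (fun p : (Σ j : Fin N, Fin (m j)) => mobius z.1 (B p.1 p.2))
          (max (∏ p : (Σ j : Fin N, Fin (m j)), ‖mobius z.1 (B p.1 p.2)‖) ‖z.2‖) := by
      rcases le_or_gt ‖z.2‖ (∏ p : (Σ j : Fin N, Fin (m j)), ‖mobius z.1 (B p.1 p.2)‖) with h | h
      · rw [max_eq_left h]
        exact Interp.self _ hαm
      · rw [max_eq_right h.le]
        exact interp _ hαinj hαm (lt_of_le_of_lt hPnn h) (mem_ud.1 hz2) h.le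
    obtain ⟨g, hg, hgm, hg0, hgζ⟩ := exists_second ζ hζ z.2 hz2 (by
      rw [hval]; exact le_max_right _ _)
    refine ⟨fun w => mobius z.1 (f w), g, fun j i => ζ ⟨j, i⟩,
      ⟨(mob_diff hz1).comp hf hfm, hg, fun w hw => mob_mem hz1 (hfm w hw), hgm⟩, ?_, hg0,
      fun j i => hζ _, fun j i => ⟨?_, hgζ _⟩, ?_⟩
    · simp [hf0, mob_zero]
    · simp only [hfζ]
      exact mob_invol hz1 (hB j i)
    · rw [hsum, hval]
  · apply le_sInf
    rintro t ⟨φ₁, φ₂, ζ, ⟨h1, h2, h3, h4⟩, h10, h20, hζ, hv, rfl⟩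
    rw [hsum]
    have hinj : Function.Injective (fun p : (Σ j : Fin N, Fin (m j)) => ζ p.1 p.2) := by
      intro p q hpq
      apply hdist
      have := congrArg φ₁ hpq
      simpa only [(hv _ _).1] using this
    refine elog_mono (le_max_of_le_right (norm_nonneg _)) (max_le ?_ ?_)
    · rw [hprod]
      refine Finset.prod_le_prod (fun _ _ => norm_nonneg _) fun p _ => ?_
      have := zeros_bound (Finset.univ : Finset Unit) (fun _ => ζ p.1 p.2)
        (fun _ _ _ => rfl) (fun _ => hζ _ _) (fun w => mobius (B p.1 p.2) (φ₁ w))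
        ((mob_diff (hB _ _)).comp h1 h3)
        (fun w hw => (mem_ud.1 (mob_mem (hB _ _) (h3 w hw))).le)
        (fun _ _ => by simp only [(hv _ _).1]; exact mob_self _)
      rw [mob_norm_symm]
      simpa [h10] using this
    · have := zeros_bound (Finset.univ : Finset (Σ j : Fin N, Fin (m j)))
        (fun p => ζ p.1 p.2) hinj (fun _ => hζ _ _) φ₂ h2
        (fun w hw => (mem_ud.1 (h4 w hw)).le) (fun p _ => (hv _ _).2)
      rwa [h20] at this

/-- Convergence of Coman's Lempert functions with simple poles
`(a^{(k)}_{j,i}, 0)` (all weights `1`), as each group of poles collides to `(a_j, 0)`,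
to the generalized Lempert/Green function with horizontal indicators. -/
theorem lempert_collision_limit_horizontal
    (N : ℕ) (a : Fin N → ℂ) (ha : ∀ j, a j ∈ unitDisc) (hinj : Function.Injective a)
    (m : Fin N → ℕ) (hm : ∀ j, 0 < m j)
    (A : ℕ → (j : Fin N) → Fin (m j) → ℂ)
    (hA : ∀ k j i, A k j i ∈ unitDisc)
    (hdist : ∀ k, Function.Injective (fun p : (Σ j : Fin N, Fin (m j)) => A k p.1 p.2))
    (hlim : ∀ j i, Tendsto (fun k => A k j i) atTop (𝓝 (a j)))
    (z : ℂ × ℂ) (hz1 : z.1 ∈ unitDisc) (hz2 : z.2 ∈ unitDisc) :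
    Tendsto (fun k => sInf { t : EReal |
        ∃ (φ₁ φ₂ : ℂ → ℂ) (ζ : (j : Fin N) → Fin (m j) → ℂ),
          AnalyticDisc2 φ₁ φ₂ ∧ φ₁ 0 = z.1 ∧ φ₂ 0 = z.2 ∧
          (∀ j i, ζ j i ∈ unitDisc) ∧
          (∀ j i, φ₁ (ζ j i) = A k j i ∧ φ₂ (ζ j i) = 0) ∧
          t = ∑ j, ∑ i, elog ‖ζ j i‖ })
      atTop
      (𝓝 (max (∑ j, ((m j : ℝ) : EReal) * elog ‖mobius (a j) z.1‖)
              (elog ‖z.2‖))) := by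
  have hk : ∀ k, _ := fun k => lempert_exact (A k) (hA k) (hdist k) z hz1 hz2
  rw [funext hk]
  have hlimit : max (∑ j, ((m j : ℝ) : EReal) * elog ‖mobius (a j) z.1‖) (elog ‖z.2‖) =
      elog (max (∏ j, ∏ _i : Fin (m j), ‖mobius (a j) z.1‖) ‖z.2‖) := by
    rw [elog_max (Finset.prod_nonneg fun _ _ => Finset.prod_nonneg fun _ _ => norm_nonneg _)
      (norm_nonneg _), elog_prod _ _ (fun _ => Finset.prod_nonneg fun _ _ => norm_nonneg _)]
    congr 1
    refine Finset.sum_congr rfl fun j _ => ?_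
    rw [Finset.prod_const, Finset.card_univ, Fintype.card_fin, elog_pow (norm_nonneg _)]
  rw [hlimit]
  refine elog_tendsto (fun _ => le_max_of_le_right (norm_nonneg _))
    (le_max_of_le_right (norm_nonneg _)) (Tendsto.max ?_ tendsto_const_nhds)
  refine tendsto_finsetProd _ fun j _ => tendsto_finsetProd _ fun i _ => ?_
  rw [mob_norm_symm (a j), funext fun k => mob_norm_symm (A k j i) z.1]
  have hc : ContinuousAt (mobius z.1) (a j) :=
    ((mob_diff hz1).differentiableAt (isOpen_ball.mem_nhds (ha j))).continuousAt
  exact (hc.tendsto.comp (hlim j i)).norm
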